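/- arXiv:1911.13006 — 2 statements merged into one kernel-verified Lean document; each statement's English description precedes it below -/
import Mathlib

section
/- Let $K_1, K_2$ be compact subsets of $[0,1]$ with $\lambda(K_1 \cap K_2) = 0$ and let $K = K_1 \cup K_2$ have positive measure. Let $f : K \to \mathbb{R}$ be continuous, mean zero on $K$, and satisfy: there is $\kappa \in \mathbb{R}$ with $\lambda(f^{-1}(\{y\})) = 0$ for all $y < \kappa$ and $f = \kappa$ on $\{f \geq \kappa\}$. Then for every $\epsilon > 0$ there exists a compact subset $E \subseteq K$ of positive measure such that $\lambda(E) \geq \lambda(K) - \epsilon$, $\int_E f\,d\lambda = 0$, and $\lambda(E \cap K_1)/\lambda(E)$ is a rational number. -/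
open MeasureTheory Set

lemma volume_ne_top_of_subset_Icc {A : Set ℝ} (hA : A ⊆ Icc 0 1) : volume A ≠ ⊤ :=
  ne_top_of_le_ne_top (by simp) (measure_mono hA)

lemma exists_volume_inter_Iio_eq {A : Set ℝ} (hsub : A ⊆ Icc 0 1) {s : ℝ}
    (hs : s ∈ Icc 0 (volume.real A)) : ∃ u, volume.real (A ∩ Iio u) = s := by
  have hfin := volume_ne_top_of_subset_Icc hsub
  have hlip : LipschitzWith 1 (fun u => volume.real (A ∩ Iio u)) := by
    refine LipschitzWith.of_le_add fun u v => ?_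
    have h : A ∩ Iio u ⊆ (A ∩ Iio v) ∪ Icc v u := by
      rintro x ⟨hx, hxu⟩
      rcases lt_or_ge x v with h | h
      · exact Or.inl ⟨hx, h⟩
      · exact Or.inr ⟨h, hxu.le⟩
    have hfin' : volume (A ∩ Iio v) ≠ ⊤ :=
      ne_top_of_le_ne_top hfin (measure_mono inter_subset_left)
    calc volume.real (A ∩ Iio u) ≤ volume.real ((A ∩ Iio v) ∪ Icc v u) :=
          measureReal_mono h (measure_union_lt_top hfin'.lt_top (by simp)).ne
      _ ≤ volume.real (A ∩ Iio v) + volume.real (Icc v u) := measureReal_union_le _ _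
      _ ≤ volume.real (A ∩ Iio v) + dist u v := by
          rw [Real.volume_real_Icc, Real.dist_eq]
          gcongr
          exact max_le (le_abs_self _) (abs_nonneg _)
  have h0 : volume.real (A ∩ Iio 0) = 0 := by
    have : A ∩ Iio 0 = ∅ := by
      ext x
      simp only [mem_inter_iff, mem_Iio, mem_empty_iff_false, iff_false, not_and, not_lt]
      exact fun hx => (hsub hx).1
    simp [this]
  have h2 : volume.real (A ∩ Iio 2) = volume.real A := by
    rw [inter_eq_left.2]
    exact fun x hx => (hsub hx).2.trans_lt one_lt_two
  have hivt := intermediate_value_Icc (zero_le_two (α := ℝ)) hlip.continuous.continuousOn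
  simp only [h0, h2] at hivt
  obtain ⟨u, -, hu⟩ := hivt hs
  exact ⟨u, hu⟩

lemma abs_setIntegral_inter_Iio_sub_le {A : Set ℝ} (hA : MeasurableSet A) (hsub : A ⊆ Icc 0 1)
    {f : ℝ → ℝ} (hf : IntegrableOn f A) {M : ℝ} (hM : ∀ x ∈ A, |f x| ≤ M) (u v : ℝ) :
    |(∫ x in A ∩ Iio u, f x) - ∫ x in A ∩ Iio v, f x| ≤
      M * |volume.real (A ∩ Iio u) - volume.real (A ∩ Iio v)| := by
  wlog huv : v ≤ u generalizing u v
  · rw [abs_sub_comm, abs_sub_comm (volume.real _)]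
    exact this v u (le_of_not_ge huv)
  have hss : A ∩ Iio v ⊆ A ∩ Iio u := inter_subset_inter_right _ (Iio_subset_Iio huv)
  have hmeas : MeasurableSet (A ∩ Iio v) := hA.inter measurableSet_Iio
  have hfin : volume (A ∩ Iio u) ≠ ⊤ :=
    volume_ne_top_of_subset_Icc (inter_subset_left.trans hsub)
  rw [← setIntegral_sdiff hmeas (hf.mono_set inter_subset_left) hss,
    ← measureReal_sdiff hss hmeas, abs_of_nonneg measureReal_nonneg]
  exact norm_setIntegral_le_of_norm_le_const (f := f)
    ((measure_mono sdiff_subset).trans_lt hfin.lt_top) fun x hx => hM x hx.1.1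

lemma exists_inter_Iio_integral_add_eq {A B : Set ℝ} (hA : MeasurableSet A) (hB : MeasurableSet B)
    (hAsub : A ⊆ Icc 0 1) (hBsub : B ⊆ Icc 0 1) {f : ℝ → ℝ} (hfA : IntegrableOn f A)
    (hfB : IntegrableOn f B) {M : ℝ} (hMA : ∀ x ∈ A, |f x| ≤ M) (hMB : ∀ x ∈ B, |f x| ≤ M)
    {b t : ℝ} (hb : 0 ≤ b) (hbA : b ≤ volume.real A) (hbB : b ≤ volume.real B)
    (hlow : ∀ p, volume.real (A ∩ Iio p) = b → ∫ x in A ∩ Iio p, f x ≤ t)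
    (hhigh : ∀ p, volume.real (B ∩ Iio p) = b → t ≤ ∫ x in B ∩ Iio p, f x) :
    ∃ p q, volume.real (A ∩ Iio p) + volume.real (B ∩ Iio q) = b ∧
      (∫ x in A ∩ Iio p, f x) + (∫ x in B ∩ Iio q, f x) = t := by
  have key : ∀ C : Set ℝ, C ⊆ Icc 0 1 → b ≤ volume.real C →
      ∃ u : ℝ → ℝ, ∀ s ∈ Icc 0 b, volume.real (C ∩ Iio (u s)) = s := by
    intro C hC hbC
    have : ∀ s, ∃ u, s ∈ Icc 0 b → volume.real (C ∩ Iio u) = s := by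
      intro s
      by_cases hs : s ∈ Icc 0 b
      · obtain ⟨u, hu⟩ := exists_volume_inter_Iio_eq hC ⟨hs.1, hs.2.trans hbC⟩
        exact ⟨u, fun _ => hu⟩
      · exact ⟨0, fun h => absurd h hs⟩
    choose u hu using this
    exact ⟨u, hu⟩
  obtain ⟨u, hu⟩ := key A hAsub hbA
  obtain ⟨v, hv⟩ := key B hBsub hbB
  have hcont : ∀ (C : Set ℝ) (w : ℝ → ℝ), MeasurableSet C → C ⊆ Icc 0 1 → IntegrableOn f C →
      (∀ x ∈ C, |f x| ≤ M) → (∀ s ∈ Icc 0 b, volume.real (C ∩ Iio (w s)) = s) →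
      ContinuousOn (fun s => ∫ x in C ∩ Iio (w s), f x) (Icc 0 b) := by
    intro C w hC hCsub hfC hMC hw
    refine (LipschitzOnWith.of_dist_le_mul (K := M.toNNReal) fun x hx y hy => ?_).continuousOn
    refine (abs_setIntegral_inter_Iio_sub_le hC hCsub hfC hMC _ _).trans ?_
    rw [hw x hx, hw y hy, Real.dist_eq]
    gcongr
    exact Real.le_coe_toNNReal M
  have hzero : ∀ (C : Set ℝ) (w : ℝ), C ⊆ Icc 0 1 → volume.real (C ∩ Iio w) = 0 →
      ∫ x in C ∩ Iio w, f x = 0 := fun C w hC h => setIntegral_measure_zero f <|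
    (measureReal_eq_zero_iff (volume_ne_top_of_subset_Icc (inter_subset_left.trans hC))).1 h
  have hsubc : MapsTo (fun s => b - s) (Icc 0 b) (Icc 0 b) := fun s hs =>
    ⟨sub_nonneg.2 hs.2, sub_le_self _ hs.1⟩
  have hF : ContinuousOn (fun s => (∫ x in A ∩ Iio (u s), f x) +
      ∫ x in B ∩ Iio (v (b - s)), f x) (Icc 0 b) :=
    (hcont A u hA hAsub hfA hMA hu).add
      ((hcont B v hB hBsub hfB hMB hv).comp (by fun_prop) hsubc)
  have h0 : (0 : ℝ) ∈ Icc 0 b := left_mem_Icc.2 hb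
  have hb' : b ∈ Icc 0 b := right_mem_Icc.2 hb
  have ht := intermediate_value_Icc' hb hF (show t ∈ _ by
    constructor
    · simp only [sub_self, hzero B (v 0) hBsub (hv 0 h0), add_zero]
      exact hlow _ (hu b hb')
    · simp only [sub_zero, hzero A (u 0) hAsub (hu 0 h0), zero_add]
      exact hhigh _ (hv b hb'))
  obtain ⟨s, hs, hst⟩ := ht
  refine ⟨u s, v (b - s), ?_, hst⟩
  rw [hu s hs, hv _ (hsubc hs)]
  ring

lemma setIntegral_lt_const_mul {S : Set ℝ} (hS : MeasurableSet S) (hsub : S ⊆ Icc 0 1)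
    {f : ℝ → ℝ} (hf : IntegrableOn f S) {c : ℝ} (hc : ∀ x ∈ S, f x < c)
    (hpos : 0 < volume.real S) : ∫ x in S, f x < c * volume.real S := by
  have hfin := volume_ne_top_of_subset_Icc hsub
  have hci : IntegrableOn (fun _ : ℝ => c) S := integrableOn_const hfin
  have h : 0 < ∫ x in S, (c - f x) := by
    rw [setIntegral_pos_iff_support_of_nonneg_ae]
    · rw [inter_eq_right.2]
      · exact (ENNReal.toReal_pos_iff.1 hpos).1
      · exact fun x hx => (sub_pos.2 (hc x hx)).ne'
    · exact (ae_restrict_mem hS).mono fun x hx => (sub_pos.2 (hc x hx)).le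
    · exact hci.sub hf
  rw [integral_sub hci hf, setIntegral_const, smul_eq_mul] at h
  linarith

lemma exists_rat_div_add_eq {x y δ : ℝ} (hx : 0 < x) (hy : 0 ≤ y) (hδ : 0 < δ) :
    ∃ z ∈ Ioo y (y + δ), ∃ q : ℚ, x / (x + z) = q := by
  have hlt : x / (x + (y + δ)) < x / (x + y) := by gcongr; linarith
  obtain ⟨q, hq₁, hq₂⟩ := exists_rat_btwn hlt
  have hq : (0 : ℝ) < q := lt_trans (by positivity) hq₁
  refine ⟨x / q - x, ⟨?_, ?_⟩, q, ?_⟩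
  · rw [lt_div_iff₀ (by positivity)] at hq₂
    rw [lt_sub_iff_add_lt, lt_div_iff₀ hq]
    linarith
  · rw [div_lt_iff₀ (by positivity)] at hq₁
    rw [sub_lt_iff_lt_add, div_lt_iff₀ hq]
    linarith
  · rw [add_sub_cancel, div_div_cancel₀ hx.ne']

lemma exists_measure_lt_pos_and_measure_gt_pos {K : Set ℝ} (hK : volume K ≠ 0)
    {f : ℝ → ℝ} (hlevel : ∀ y, volume (K ∩ f ⁻¹' {y}) = 0) :
    ∃ c, 0 < volume (K ∩ f ⁻¹' Iio c) ∧ 0 < volume (K ∩ f ⁻¹' Ioi c) := by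
  by_contra! hcon
  simp only [nonpos_iff_eq_zero, pos_iff_ne_zero] at hcon
  set S : Set ℝ := {c | volume (K ∩ f ⁻¹' Iio c) = 0} with hS
  have hmono : ∀ {c d}, c ≤ d → d ∈ S → c ∈ S := fun h hd =>
    measure_mono_null (inter_subset_inter_right _ (preimage_mono (Iio_subset_Iio h))) hd
  have hne : S.Nonempty := by
    by_contra hne
    rw [not_nonempty_iff_eq_empty] at hne
    refine hK (measure_mono_null (t := ⋃ n : ℕ, K ∩ f ⁻¹' Ioi (-n : ℝ)) ?_
      (measure_iUnion_null fun n => hcon _ fun h => ?_))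
    · intro x hx
      obtain ⟨n, hn⟩ := exists_nat_gt (-f x)
      exact mem_iUnion.2 ⟨n, hx, by simp only [mem_preimage, mem_Ioi]; linarith⟩
    · exact (eq_empty_iff_forall_notMem.1 hne) _ h
  have hbdd : BddAbove S := by
    by_contra hb
    rw [not_bddAbove_iff] at hb
    refine hK (measure_mono_null (t := ⋃ n : ℕ, K ∩ f ⁻¹' Iio (n : ℝ)) ?_
      (measure_iUnion_null fun n => ?_))
    · intro x hx
      obtain ⟨n, hn⟩ := exists_nat_gt (f x)
      exact mem_iUnion.2 ⟨n, hx, hn⟩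
    · obtain ⟨d, hd, hnd⟩ := hb n
      exact hmono hnd.le hd
  have hlow : volume (K ∩ f ⁻¹' Iio (sSup S)) = 0 := by
    refine measure_mono_null (t := ⋃ n : ℕ, K ∩ f ⁻¹' Iio (sSup S - 1 / (n + 1))) ?_
      (measure_iUnion_null fun n => ?_)
    · rintro x ⟨hx, hlt⟩
      obtain ⟨n, hn⟩ := exists_nat_one_div_lt (K := ℝ) (sub_pos.2 hlt)
      exact mem_iUnion.2 ⟨n, hx, by simp only [mem_preimage, mem_Iio]; linarith⟩
    · obtain ⟨d, hd, hnd⟩ := exists_lt_of_lt_csSup hne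
        (sub_lt_self (sSup S) (Nat.one_div_pos_of_nat (n := n)))
      exact hmono hnd.le hd
  have hhigh : volume (K ∩ f ⁻¹' Ioi (sSup S)) = 0 := by
    refine measure_mono_null (t := ⋃ n : ℕ, K ∩ f ⁻¹' Ioi (sSup S + 1 / (n + 1))) ?_
      (measure_iUnion_null fun n => hcon _ fun h => ?_)
    · rintro x ⟨hx, hlt⟩
      obtain ⟨n, hn⟩ := exists_nat_one_div_lt (K := ℝ) (sub_pos.2 hlt)
      exact mem_iUnion.2 ⟨n, hx, by simp only [mem_preimage, mem_Ioi]; linarith⟩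
    · have := le_csSup hbdd h
      have := Nat.one_div_pos_of_nat (α := ℝ) (n := n)
      linarith
  refine hK (measure_mono_null ?_ (measure_union_null (measure_union_null hlow hhigh)
    (hlevel (sSup S))))
  intro x hx
  rcases lt_trichotomy (f x) (sSup S) with h | h | h
  · exact Or.inl (Or.inl ⟨hx, h⟩)
  · exact Or.inr ⟨hx, h⟩
  · exact Or.inl (Or.inr ⟨hx, h⟩)

lemma exists_compact_rational_ratio_of_cut {K₁ K₂ E₁ : Set ℝ} (h₁ : IsCompact K₁)
    (h₂ : IsCompact K₂) (hE₁ : IsCompact E₁) (hE₁K₁ : E₁ ⊆ K₁) (hsub : K₁ ⊆ Icc 0 1)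
    (hsub' : K₂ ⊆ Icc 0 1) (hint : volume (K₁ ∩ K₂) = 0) {f : ℝ → ℝ}
    (hcont : ContinuousOn f (K₁ ∪ K₂)) {c b₀ : ℝ} (hb₀ : 0 < b₀)
    (hbA : b₀ ≤ volume.real (K₂ ∩ f ⁻¹' Iio c)) (hbB : b₀ ≤ volume.real (K₂ ∩ f ⁻¹' Ioi c))
    (hpos : 0 < volume.real E₁) (hmean : (∫ x in E₁, f x) + ∫ x in K₂, f x = c * b₀) :
    ∃ E : Set ℝ, IsCompact E ∧ E ⊆ K₁ ∪ K₂ ∧ 0 < volume E ∧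
      volume.real E₁ + volume.real K₂ - b₀ ≤ volume.real E ∧ (∫ x in E, f x) = 0 ∧
      ∃ q : ℚ, volume.real (E ∩ K₁) / volume.real E = q := by
  obtain ⟨M, hM⟩ := (h₁.union h₂).exists_bound_of_continuousOn hcont
  have hM0 : 0 ≤ |M| := abs_nonneg M
  replace hM : ∀ x ∈ K₁ ∪ K₂, |f x| ≤ |M| := fun x hx => (hM x hx).trans (le_abs_self M)
  have hcont₂ : ContinuousOn f K₂ := hcont.mono subset_union_right
  have hfK : IntegrableOn f (K₁ ∪ K₂) := hcont.integrableOn_compact (h₁.union h₂)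
  have hf₂ : IntegrableOn f K₂ := hfK.mono_set subset_union_right
  have hf₁ : IntegrableOn f E₁ := hfK.mono_set (hE₁K₁.trans subset_union_left)
  have hmeas : ∀ {U : Set ℝ}, IsOpen U → MeasurableSet (K₂ ∩ f ⁻¹' U) := fun {U} hU => by
    have h := hcont₂.preimage_isClosed_of_isClosed h₂.isClosed hU.isClosed_compl
    have : K₂ ∩ f ⁻¹' U = K₂ \ (K₂ ∩ f ⁻¹' Uᶜ) := by ext x; simp
    rw [this]
    exact h₂.measurableSet.diff h.measurableSet
  set A := K₂ ∩ f ⁻¹' Iio c with hA_def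
  set B := K₂ ∩ f ⁻¹' Ioi c with hB_def
  have hA : MeasurableSet A := hmeas isOpen_Iio
  have hB : MeasurableSet B := hmeas isOpen_Ioi
  have hAK : A ⊆ K₂ := inter_subset_left
  have hBK : B ⊆ K₂ := inter_subset_left
  have hMA : ∀ x ∈ A, |f x| ≤ |M| := fun x hx => hM x (Or.inr hx.1)
  have hMB : ∀ x ∈ B, |f x| ≤ |M| := fun x hx => hM x (Or.inr hx.1)
  obtain ⟨p₀, hp₀⟩ := exists_volume_inter_Iio_eq (hAK.trans hsub') ⟨hb₀.le, hbA⟩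
  obtain ⟨q₀, hq₀⟩ := exists_volume_inter_Iio_eq (hBK.trans hsub') ⟨hb₀.le, hbB⟩
  have hlt : ∫ x in A ∩ Iio p₀, f x < c * b₀ := by
    have := setIntegral_lt_const_mul (hA.inter measurableSet_Iio)
      (inter_subset_left.trans (hAK.trans hsub')) (hf₂.mono_set (inter_subset_left.trans hAK))
      (c := c) (fun x hx => hx.1.2) (by rw [hp₀]; exact hb₀)
    rwa [hp₀] at this
  have hgt : c * b₀ < ∫ x in B ∩ Iio q₀, f x := by
    have := setIntegral_lt_const_mul (hB.inter measurableSet_Iio)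
      (inter_subset_left.trans (hBK.trans hsub'))
      (hf₂.mono_set (inter_subset_left.trans hBK)).neg
      (c := -c) (fun x hx => neg_lt_neg hx.1.2) (by rw [hq₀]; exact hb₀)
    simp only [Pi.neg_apply, integral_neg, hq₀] at this
    linarith
  obtain ⟨δ, hδ, hδb, hδA, hδB⟩ : ∃ δ > 0, δ ≤ b₀ ∧
      (∫ x in A ∩ Iio p₀, f x) + |M| * δ ≤ c * b₀ ∧
      c * b₀ ≤ (∫ x in B ∩ Iio q₀, f x) - |M| * δ := by
    set a := c * b₀ - ∫ x in A ∩ Iio p₀, f x with ha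
    set a' := (∫ x in B ∩ Iio q₀, f x) - c * b₀ with ha'
    have hpa : 0 < min a a' := lt_min (sub_pos.2 hlt) (sub_pos.2 hgt)
    have hle : |M| * min b₀ (min a a' / (|M| + 1)) ≤ min a a' := by
      calc |M| * min b₀ (min a a' / (|M| + 1)) ≤ (|M| + 1) * (min a a' / (|M| + 1)) := by
            gcongr
            · linarith
            · exact min_le_right _ _
        _ = min a a' := by field_simp
    refine ⟨min b₀ (min a a' / (|M| + 1)), lt_min hb₀ (by positivity), min_le_left _ _, ?_, ?_⟩
    · linarith [min_le_left a a']
    · linarith [min_le_right a a']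
  have hK₂b : b₀ ≤ volume.real K₂ :=
    hbA.trans (measureReal_mono hAK (volume_ne_top_of_subset_Icc hsub'))
  obtain ⟨z, ⟨hz₁, hz₂⟩, r, hr⟩ := exists_rat_div_add_eq hpos (sub_nonneg.2 hK₂b) hδ
  set b := volume.real K₂ - z with hb
  have hbb₀ : b ≤ b₀ := by linarith
  have hbδ : b₀ - b ≤ δ := by linarith
  have habs : |b - b₀| ≤ δ := abs_le.2 ⟨by linarith, by linarith⟩
  obtain ⟨p, q, hpq, hpqint⟩ := exists_inter_Iio_integral_add_eq hA hB (hAK.trans hsub')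
    (hBK.trans hsub') (hf₂.mono_set hAK) (hf₂.mono_set hBK) hMA hMB (b := b) (t := c * b₀)
    (by linarith) (hbb₀.trans hbA) (hbb₀.trans hbB)
    (fun p hp => by
      have := abs_setIntegral_inter_Iio_sub_le hA (hAK.trans hsub') (hf₂.mono_set hAK) hMA p p₀
      rw [hp, hp₀] at this
      have h := (le_abs_self _).trans (this.trans (mul_le_mul_of_nonneg_left habs hM0))
      linarith)
    (fun q hq => by
      have := abs_setIntegral_inter_Iio_sub_le hB (hBK.trans hsub') (hf₂.mono_set hBK) hMB q q₀
      rw [hq, hq₀] at this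
      have h := (neg_le_abs _).trans (this.trans (mul_le_mul_of_nonneg_left habs hM0))
      linarith)
  have hdisj : Disjoint (A ∩ Iio p) (B ∩ Iio q) :=
    Set.disjoint_left.2 fun x hx hx' => lt_asymm (show f x < c from hx.1.2) hx'.1.2
  set R := (A ∩ Iio p) ∪ (B ∩ Iio q) with hR
  have hRK : R ⊆ K₂ :=
    union_subset (inter_subset_left.trans hAK) (inter_subset_left.trans hBK)
  have hBm : MeasurableSet (B ∩ Iio q) := hB.inter measurableSet_Iio
  have hRm : MeasurableSet R := (hA.inter measurableSet_Iio).union hBm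
  have hRvol : volume.real R = b := by
    rw [hR, measureReal_union hdisj hBm
      (volume_ne_top_of_subset_Icc (inter_subset_left.trans (hAK.trans hsub')))
      (volume_ne_top_of_subset_Icc (inter_subset_left.trans (hBK.trans hsub'))), hpq]
  have hRint : ∫ x in R, f x = c * b₀ := by
    rw [hR, setIntegral_union hdisj hBm (hf₂.mono_set (inter_subset_left.trans hAK))
      (hf₂.mono_set (inter_subset_left.trans hBK)), hpqint]
  have hclosed : IsClosed (K₂ \ R) := by
    have : K₂ \ R = ((K₂ ∩ f ⁻¹' Ici c) ∪ (K₂ ∩ Ici p)) ∩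
        ((K₂ ∩ f ⁻¹' Iic c) ∪ (K₂ ∩ Ici q)) := by
      ext x
      simp only [hR, hA_def, hB_def, mem_sdiff, mem_union, mem_inter_iff, mem_preimage, mem_Iio,
        mem_Ioi, mem_Ici, mem_Iic, ← not_lt]
      tauto
    rw [this]
    exact ((hcont₂.preimage_isClosed_of_isClosed h₂.isClosed isClosed_Ici).union
      (h₂.isClosed.inter isClosed_Ici)).inter
      ((hcont₂.preimage_isClosed_of_isClosed h₂.isClosed isClosed_Iic).union
      (h₂.isClosed.inter isClosed_Ici))
  have hcomp : IsCompact (K₂ \ R) := h₂.of_isClosed_subset hclosed sdiff_subset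
  have hE₂vol : volume.real (K₂ \ R) = z := by
    rw [measureReal_sdiff hRK hRm (volume_ne_top_of_subset_Icc hsub'), hRvol, hb]
    ring
  have hE₂int : ∫ x in K₂ \ R, f x = (∫ x in K₂, f x) - c * b₀ := by
    rw [setIntegral_sdiff hRm hf₂ hRK, hRint]
  have haed : AEDisjoint volume E₁ (K₂ \ R) :=
    measure_mono_null (inter_subset_inter hE₁K₁ sdiff_subset) hint
  have hE₁top := volume_ne_top_of_subset_Icc (hE₁K₁.trans hsub)
  have hE₂top := volume_ne_top_of_subset_Icc ((sdiff_subset (t := R)).trans hsub')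
  have hEvol : volume.real (E₁ ∪ K₂ \ R) = volume.real E₁ + z := by
    rw [measureReal_union₀ hclosed.measurableSet.nullMeasurableSet haed hE₁top hE₂top, hE₂vol]
  have hEK₁ : volume.real ((E₁ ∪ K₂ \ R) ∩ K₁) = volume.real E₁ := by
    have hnull : AEDisjoint volume E₁ ((K₂ \ R) ∩ K₁) :=
      measure_mono_null (t := K₁ ∩ K₂) (fun x hx => ⟨hE₁K₁ hx.1, hx.2.1.1⟩) hint
    have hz : volume ((K₂ \ R) ∩ K₁) = 0 :=
      measure_mono_null (t := K₁ ∩ K₂) (fun x hx => ⟨hx.2, hx.1.1⟩) hint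
    rw [union_inter_distrib_right, inter_eq_left.2 hE₁K₁,
      measureReal_union₀ (hclosed.measurableSet.inter h₁.measurableSet).nullMeasurableSet hnull
        hE₁top (by simp [hz]), (measureReal_eq_zero_iff (by simp [hz])).2 hz, add_zero]
  refine ⟨E₁ ∪ K₂ \ R, hE₁.union hcomp, union_subset_union hE₁K₁ sdiff_subset, ?_, ?_, ?_, r, ?_⟩
  · exact (ENNReal.toReal_pos_iff.1 hpos).1.trans_le (measure_mono subset_union_left)
  · rw [hEvol]
    linarith
  · rw [setIntegral_union₀ haed hclosed.measurableSet.nullMeasurableSet hf₁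
      (hf₂.mono_set sdiff_subset), hE₂int]
    linarith
  · rw [hEK₁, hEvol, hr]

/-- Up to measure `ε`, the set `K₁ ∪ K₂` can be replaced by a compact subset on which `f` has mean
zero and in which `K₁` has rational density. -/
def HasRationalCut (K₁ K₂ : Set ℝ) (f : ℝ → ℝ) (ε : ℝ) : Prop :=
  ∃ E : Set ℝ, IsCompact E ∧ E ⊆ K₁ ∪ K₂ ∧ 0 < volume E ∧
    volume.real (K₁ ∪ K₂) - ε ≤ volume.real E ∧ (∫ x in E, f x) = 0 ∧
    ∃ q : ℚ, volume.real (E ∩ K₁) / volume.real E = q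

section

variable {K₁ K₂ : Set ℝ} {f : ℝ → ℝ} {ε : ℝ}

lemma HasRationalCut.symm (h₁ : IsCompact K₁) (h₂ : IsCompact K₂)
    (hint : volume (K₁ ∩ K₂) = 0) (h : HasRationalCut K₁ K₂ f ε) : HasRationalCut K₂ K₁ f ε := by
  obtain ⟨E, hE, hEK, hpos, hvol, hf, q, hq⟩ := h
  refine ⟨E, hE, union_comm K₁ K₂ ▸ hEK, hpos, union_comm K₁ K₂ ▸ hvol, hf, 1 - q, ?_⟩
  have hne : volume.real E ≠ 0 := (ENNReal.toReal_pos hpos.ne' hE.measure_lt_top.ne).ne'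
  have hsum : volume.real E = volume.real (E ∩ K₁) + volume.real (E ∩ K₂) := by
    rw [← measureReal_union₀ (hE.measurableSet.inter h₂.measurableSet).nullMeasurableSet
      (measure_mono_null (inter_subset_inter inter_subset_right inter_subset_right) hint)
      (hE.inter h₁).measure_lt_top.ne (hE.inter h₂).measure_lt_top.ne,
      ← inter_union_distrib_left, inter_eq_left.2 hEK]
  push_cast
  rw [← hq, eq_sub_iff_add_eq, ← add_div, add_comm, ← hsum, div_self hne]

lemma hasRationalCut_of_null_left (h₁ : IsCompact K₁) (h₂ : IsCompact K₂)
    (hpos : 0 < volume (K₁ ∪ K₂)) (hmean : ∫ x in K₁ ∪ K₂, f x = 0) (hε : 0 < ε)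
    (hnull : volume K₁ = 0) : HasRationalCut K₁ K₂ f ε := by
  refine ⟨K₁ ∪ K₂, h₁.union h₂, subset_rfl, hpos, by linarith, hmean, 0, ?_⟩
  rw [inter_eq_right.2 subset_union_left, measureReal_def, hnull]
  simp

lemma hasRationalCut_of_sign_change (h₁ : IsCompact K₁) (h₂ : IsCompact K₂)
    (hsub : K₁ ⊆ Icc 0 1) (hsub' : K₂ ⊆ Icc 0 1) (hint : volume (K₁ ∩ K₂) = 0)
    (hcont : ContinuousOn f (K₁ ∪ K₂)) (hmean : ∫ x in K₁ ∪ K₂, f x = 0) (hε : 0 < ε)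
    (hpos : 0 < volume K₁) (hneg' : 0 < volume (K₂ ∩ f ⁻¹' Iio 0))
    (hpos' : 0 < volume (K₂ ∩ f ⁻¹' Ioi 0)) : HasRationalCut K₁ K₂ f ε := by
  have hfK : IntegrableOn f (K₁ ∪ K₂) := hcont.integrableOn_compact (h₁.union h₂)
  have hnull : NullMeasurableSet K₂ := h₂.measurableSet.nullMeasurableSet
  have hA := ENNReal.toReal_pos hneg'.ne'
    (volume_ne_top_of_subset_Icc (inter_subset_left.trans hsub'))
  have hB := ENNReal.toReal_pos hpos'.ne'
    (volume_ne_top_of_subset_Icc (inter_subset_left.trans hsub'))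
  obtain ⟨E, hE, hEK, hE0, hvol, hf, hq⟩ := exists_compact_rational_ratio_of_cut h₁ h₂ h₁
    subset_rfl hsub hsub' hint hcont (c := 0) (lt_min hε (lt_min hA hB))
    ((min_le_right _ _).trans (min_le_left _ _)) ((min_le_right _ _).trans (min_le_right _ _))
    (ENNReal.toReal_pos hpos.ne' h₁.measure_lt_top.ne)
    (by rw [← setIntegral_union₀ hint hnull (hfK.mono_set subset_union_left)
          (hfK.mono_set subset_union_right), hmean, zero_mul])
  refine ⟨E, hE, hEK, hE0, le_trans ?_ hvol, hf, hq⟩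
  rw [measureReal_union₀ hnull hint h₁.measure_lt_top.ne h₂.measure_lt_top.ne]
  gcongr
  exact min_le_left _ _

lemma hasRationalCut_of_pos_of_neg (h₁ : IsCompact K₁) (h₂ : IsCompact K₂)
    (hsub : K₁ ⊆ Icc 0 1) (hsub' : K₂ ⊆ Icc 0 1) (hint : volume (K₁ ∩ K₂) = 0)
    (hcont : ContinuousOn f (K₁ ∪ K₂)) (hmean : ∫ x in K₁ ∪ K₂, f x = 0) (hε : 0 < ε)
    (hlevel : ∀ y < 0, volume ((K₁ ∪ K₂) ∩ f ⁻¹' {y}) = 0)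
    (hpos : 0 < volume K₁) (hpos' : 0 < volume K₂) (hf₁ : volume (K₁ ∩ f ⁻¹' Iic 0) = 0)
    (hf₂ : volume (K₂ ∩ f ⁻¹' Ici 0) = 0) : HasRationalCut K₁ K₂ f ε := by
  have hfK : IntegrableOn f (K₁ ∪ K₂) := hcont.integrableOn_compact (h₁.union h₂)
  have hnull : NullMeasurableSet K₂ := h₂.measurableSet.nullMeasurableSet
  obtain ⟨M, hM⟩ := (h₁.union h₂).exists_bound_of_continuousOn hcont
  obtain ⟨c, hcA, hcB⟩ := exists_measure_lt_pos_and_measure_gt_pos hpos'.ne' (f := f) fun y => by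
    rcases lt_or_ge y 0 with hy | hy
    · exact measure_mono_null (inter_subset_inter_left _ subset_union_right) (hlevel y hy)
    · refine measure_mono_null (inter_subset_inter_right _ (preimage_mono ?_)) hf₂
      exact singleton_subset_iff.2 hy
  have hc : c < 0 := by
    by_contra! hc
    exact hcB.ne' (measure_mono_null (inter_subset_inter_right _ (preimage_mono
      (Ioi_subset_Ici hc))) hf₂)
  have hA := ENNReal.toReal_pos hcA.ne'
    (volume_ne_top_of_subset_Icc (inter_subset_left.trans hsub'))
  have hB := ENNReal.toReal_pos hcB.ne'
    (volume_ne_top_of_subset_Icc (inter_subset_left.trans hsub'))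
  have hK₁ : 0 < volume.real K₁ := ENNReal.toReal_pos hpos.ne' h₁.measure_lt_top.ne
  set m := min (ε / 2) (min (volume.real (K₂ ∩ f ⁻¹' Iio c)) (volume.real (K₂ ∩ f ⁻¹' Ioi c)))
    with hm_def
  have hm : 0 < m := lt_min (half_pos hε) (lt_min hA hB)
  have hc' : 0 < -c := neg_pos.2 hc
  have hM1 : 0 < |M| + 1 := by positivity
  obtain ⟨d, hd, hdK, hdε, hdm⟩ : ∃ d > 0, d < volume.real K₁ ∧ d ≤ ε / 2 ∧
      |M| * d ≤ -c * m := by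
    refine ⟨min (volume.real K₁ / 2) (min (ε / 2) (-c * m / (|M| + 1))), by positivity,
      (min_le_left _ _).trans_lt (half_lt_self hK₁),
      (min_le_right _ _).trans (min_le_left _ _), ?_⟩
    calc _ ≤ (|M| + 1) * (-c * m / (|M| + 1)) := by
          gcongr
          · linarith
          · exact (min_le_right _ _).trans (min_le_right _ _)
      _ = -c * m := by field_simp
  obtain ⟨u, hu⟩ := exists_volume_inter_Iio_eq hsub ⟨hd.le, hdK.le⟩
  have hf₁K : IntegrableOn f K₁ := hfK.mono_set subset_union_left
  have hfD : IntegrableOn f (K₁ ∩ Iio u) := hf₁K.mono_set inter_subset_left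
  have hDm : MeasurableSet (K₁ ∩ Iio u) := h₁.measurableSet.inter measurableSet_Iio
  have hDtop : volume (K₁ ∩ Iio u) < ⊤ :=
    (measure_mono inter_subset_left).trans_lt h₁.measure_lt_top
  have hDpos : 0 < ∫ x in K₁ ∩ Iio u, f x := by
    rw [setIntegral_pos_iff_support_of_nonneg_ae _ hfD]
    · have hD : 0 < volume (K₁ ∩ Iio u) := (ENNReal.toReal_pos_iff.1 (hd.trans_eq hu.symm)).1
      rw [← measure_sdiff_null hf₁] at hD
      refine hD.trans_le (measure_mono fun x hx => ⟨fun h0 => hx.2 ⟨hx.1.1, h0.le⟩, hx.1⟩)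
    · rw [Filter.EventuallyLE, ae_restrict_iff' hDm, ae_iff]
      refine measure_mono_null (fun x hx => ?_) hf₁
      simp only [Pi.zero_apply, mem_ofPred_eq, Classical.not_imp, not_le] at hx
      exact ⟨hx.1.1, hx.2.le⟩
  have hDle : ∫ x in K₁ ∩ Iio u, f x ≤ -c * m := by
    refine ((le_abs_self _).trans (norm_setIntegral_le_of_norm_le_const (C := |M|) hDtop
      fun x hx => (hM x (Or.inl hx.1)).trans (le_abs_self M))).trans ?_
    rwa [hu]
  have hb₀m : (∫ x in K₁ ∩ Iio u, f x) / -c ≤ m := (div_le_iff₀' hc').2 hDle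
  have hE₁vol : volume.real (K₁ \ Iio u) = volume.real K₁ - d := by
    rw [← sdiff_self_inter, measureReal_sdiff inter_subset_left hDm h₁.measure_lt_top.ne, hu]
  have hE₁int : ∫ x in K₁ \ Iio u, f x = (∫ x in K₁, f x) - ∫ x in K₁ ∩ Iio u, f x := by
    rw [← sdiff_self_inter, setIntegral_sdiff hDm hf₁K inter_subset_left]
  obtain ⟨E, hE, hEK, hE0, hvol, hf, hq⟩ := exists_compact_rational_ratio_of_cut h₁ h₂
    (h₁.diff isOpen_Iio) sdiff_subset hsub hsub' hint hcont (c := c) (div_pos hDpos hc')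
    (hb₀m.trans ((min_le_right _ _).trans (min_le_left _ _)))
    (hb₀m.trans ((min_le_right _ _).trans (min_le_right _ _)))
    (by rw [hE₁vol]; linarith)
    (by
      rw [setIntegral_union₀ hint hnull hf₁K (hfK.mono_set subset_union_right)] at hmean
      rw [hE₁int, div_neg, mul_neg, mul_div_cancel₀ _ hc.ne]
      linarith)
  refine ⟨E, hE, hEK, hE0, le_trans ?_ hvol, hf, hq⟩
  rw [measureReal_union₀ hnull hint h₁.measure_lt_top.ne h₂.measure_lt_top.ne, hE₁vol]
  have := hb₀m.trans (min_le_left _ _)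
  linarith

lemma hasRationalCut_of_null_levels (h₁ : IsCompact K₁) (h₂ : IsCompact K₂)
    (hsub : K₁ ⊆ Icc 0 1) (hsub' : K₂ ⊆ Icc 0 1) (hint : volume (K₁ ∩ K₂) = 0)
    (hpos : 0 < volume (K₁ ∪ K₂))
    (hcont : ContinuousOn f (K₁ ∪ K₂)) (hmean : ∫ x in K₁ ∪ K₂, f x = 0) (hε : 0 < ε)
    (hlevel : ∀ y ≤ 0, volume ((K₁ ∪ K₂) ∩ f ⁻¹' {y}) = 0) : HasRationalCut K₁ K₂ f ε := by
  have hfK : IntegrableOn f (K₁ ∪ K₂) := hcont.integrableOn_compact (h₁.union h₂)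
  have hint' : volume (K₂ ∩ K₁) = 0 := inter_comm K₁ K₂ ▸ hint
  have hpos' : 0 < volume (K₂ ∪ K₁) := union_comm K₁ K₂ ▸ hpos
  have hcont' : ContinuousOn f (K₂ ∪ K₁) := union_comm K₁ K₂ ▸ hcont
  have hmean' : ∫ x in K₂ ∪ K₁, f x = 0 := union_comm K₁ K₂ ▸ hmean
  have hlevel' : ∀ y < 0, volume ((K₂ ∪ K₁) ∩ f ⁻¹' {y}) = 0 := fun y hy =>
    union_comm K₁ K₂ ▸ hlevel y hy.le
  rcases eq_zero_or_pos (volume K₁) with hK₁ | hK₁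
  · exact hasRationalCut_of_null_left h₁ h₂ hpos hmean hε hK₁
  rcases eq_zero_or_pos (volume K₂) with hK₂ | hK₂
  · exact (hasRationalCut_of_null_left h₂ h₁ hpos' hmean' hε hK₂).symm h₂ h₁ hint'
  have hIic : ∀ {C}, C ⊆ K₁ ∪ K₂ → volume (C ∩ f ⁻¹' Iio 0) = 0 →
      volume (C ∩ f ⁻¹' Iic 0) = 0 := fun {C} hC h => by
    rw [← Iio_union_right, preimage_union, inter_union_distrib_left]
    exact measure_union_null h
      (measure_mono_null (inter_subset_inter_left _ hC) (hlevel 0 le_rfl))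
  have hIci : ∀ {C}, C ⊆ K₁ ∪ K₂ → volume (C ∩ f ⁻¹' Ioi 0) = 0 →
      volume (C ∩ f ⁻¹' Ici 0) = 0 := fun {C} hC h => by
    rw [← Ioi_union_left, preimage_union, inter_union_distrib_left]
    exact measure_union_null h
      (measure_mono_null (inter_subset_inter_left _ hC) (hlevel 0 le_rfl))
  have hzero : ¬ f =ᵐ[volume.restrict (K₁ ∪ K₂)] 0 := fun h => by
    rw [Filter.EventuallyEq, ae_restrict_iff' (h₁.union h₂).measurableSet, ae_iff] at h
    refine hpos.ne' (measure_mono_null ?_ (measure_union_null h (hlevel 0 le_rfl)))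
    intro x hx
    by_cases h0 : f x = 0
    · exact Or.inr ⟨hx, h0⟩
    · exact Or.inl fun h => h0 (h hx)
  rcases eq_zero_or_pos (volume (K₁ ∩ f ⁻¹' Iio 0)) with hN₁ | hN₁
  · rcases eq_zero_or_pos (volume (K₂ ∩ f ⁻¹' Iio 0)) with hN₂ | hN₂
    · refine absurd ((setIntegral_eq_zero_iff_of_nonneg_ae ?_ hfK).1 hmean) hzero
      rw [Filter.EventuallyLE, ae_restrict_iff' (h₁.union h₂).measurableSet, ae_iff]
      refine measure_mono_null (fun x hx => ?_) (measure_union_null hN₁ hN₂)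
      simp only [Pi.zero_apply, mem_ofPred_eq, Classical.not_imp, not_le] at hx
      exact hx.1.imp (fun h => ⟨h, hx.2⟩) (fun h => ⟨h, hx.2⟩)
    · rcases eq_zero_or_pos (volume (K₂ ∩ f ⁻¹' Ioi 0)) with hP₂ | hP₂
      · exact hasRationalCut_of_pos_of_neg h₁ h₂ hsub hsub' hint hcont hmean hε
          (fun y hy => hlevel y hy.le) hK₁ hK₂ (hIic subset_union_left hN₁)
          (hIci subset_union_right hP₂)
      · exact hasRationalCut_of_sign_change h₁ h₂ hsub hsub' hint hcont hmean hε hK₁ hN₂ hP₂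
  · rcases eq_zero_or_pos (volume (K₁ ∩ f ⁻¹' Ioi 0)) with hP₁ | hP₁
    · rcases eq_zero_or_pos (volume (K₂ ∩ f ⁻¹' Ioi 0)) with hP₂ | hP₂
      · have hmeanneg : ∫ x in K₁ ∪ K₂, (-f) x = 0 := by
          simp only [Pi.neg_apply, integral_neg, hmean, neg_zero]
        have h := (setIntegral_eq_zero_iff_of_nonneg_ae ?_ hfK.neg).1 hmeanneg
        · exact absurd (h.mono fun x hx => neg_eq_zero.1 hx) hzero
        rw [Filter.EventuallyLE, ae_restrict_iff' (h₁.union h₂).measurableSet, ae_iff]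
        refine measure_mono_null (fun x hx => ?_) (measure_union_null hP₁ hP₂)
        simp only [Pi.zero_apply, Pi.neg_apply, mem_ofPred_eq, Classical.not_imp, not_le,
          neg_lt_zero] at hx
        exact hx.1.imp (fun h => ⟨h, hx.2⟩) (fun h => ⟨h, hx.2⟩)
      · rcases eq_zero_or_pos (volume (K₂ ∩ f ⁻¹' Iio 0)) with hN₂ | hN₂
        · exact (hasRationalCut_of_pos_of_neg h₂ h₁ hsub' hsub hint' hcont' hmean' hε hlevel'
            hK₂ hK₁ (hIic subset_union_right hN₂) (hIci subset_union_left hP₁)).symm h₂ h₁ hint'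
        · exact hasRationalCut_of_sign_change h₁ h₂ hsub hsub' hint hcont hmean hε hK₁ hN₂ hP₂
    · exact (hasRationalCut_of_sign_change h₂ h₁ hsub' hsub hint' hcont' hmean' hε hK₂ hN₁
        hP₁).symm h₂ h₁ hint'

lemma hasRationalCut_of_ae_eq_zero (h₁ : IsCompact K₁) (h₂ : IsCompact K₂)
    (hsub : K₁ ⊆ Icc 0 1) (hsub' : K₂ ⊆ Icc 0 1) (hint : volume (K₁ ∩ K₂) = 0)
    (hpos : 0 < volume (K₁ ∪ K₂)) (hε : 0 < ε)
    (hzero : f =ᵐ[volume.restrict (K₁ ∪ K₂)] 0) : HasRationalCut K₁ K₂ f ε := by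
  have hK := (h₁.union h₂).measure_lt_top (μ := volume)
  have hK0 : volume.real (K₁ ∪ K₂) ≠ 0 := (ENNReal.toReal_pos hpos.ne' hK.ne).ne'
  set a := (∫ x in K₁ ∪ K₂, x) / volume.real (K₁ ∪ K₂) with ha
  have hid : IntegrableOn (fun x : ℝ => x) (K₁ ∪ K₂) :=
    continuousOn_id.integrableOn_compact (h₁.union h₂)
  obtain ⟨E, hE, hEK, hE0, hvol, -, hq⟩ := hasRationalCut_of_null_levels (f := fun x => x - a)
    h₁ h₂ hsub hsub' hint hpos (by fun_prop)
    (by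
      rw [integral_sub hid (integrableOn_const hK.ne), setIntegral_const, smul_eq_mul, ha]
      field_simp
      ring) hε
    (fun y _ => measure_mono_null
      (fun x hx => show x ∈ ({y + a} : Set ℝ) from eq_add_of_sub_eq hx.2) (by simp))
  refine ⟨E, hE, hEK, hE0, hvol, ?_, hq⟩
  exact integral_eq_zero_of_ae (ae_restrict_of_ae_restrict_of_subset hEK hzero)

end

theorem stmt7 (K₁ K₂ : Set ℝ) (h₁ : IsCompact K₁) (h₂ : IsCompact K₂)
    (hsub : K₁ ⊆ Set.Icc 0 1) (hsub' : K₂ ⊆ Set.Icc 0 1)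
    (hint : volume (K₁ ∩ K₂) = 0) (hpos : 0 < volume (K₁ ∪ K₂))
    (f : ℝ → ℝ) (hcont : ContinuousOn f (K₁ ∪ K₂))
    (hmean : ∫ x in K₁ ∪ K₂, f x = 0) (κ : ℝ)
    (hlevel : ∀ y < κ, volume ((K₁ ∪ K₂) ∩ f ⁻¹' {y}) = 0)
    (hconst : ∀ x ∈ K₁ ∪ K₂, κ ≤ f x → f x = κ)
    (ε : ℝ) (hε : 0 < ε) :
    ∃ E : Set ℝ, IsCompact E ∧ E ⊆ K₁ ∪ K₂ ∧ 0 < volume E ∧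
      (volume (K₁ ∪ K₂)).toReal - ε ≤ (volume E).toReal ∧
      (∫ x in E, f x) = 0 ∧
      ∃ q : ℚ, (volume (E ∩ K₁)).toReal / (volume E).toReal = (q : ℝ) := by
  rcases lt_or_ge 0 κ with hκ | hκ
  · exact hasRationalCut_of_null_levels h₁ h₂ hsub hsub' hint hpos hcont hmean hε
      fun y hy => hlevel y (hy.trans_lt hκ)
  · refine hasRationalCut_of_ae_eq_zero h₁ h₂ hsub hsub' hint hpos hε ?_
    have hfK : IntegrableOn f (K₁ ∪ K₂) := hcont.integrableOn_compact (h₁.union h₂)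
    have hmeanneg : ∫ x in K₁ ∪ K₂, (-f) x = 0 := by
      simp only [Pi.neg_apply, integral_neg, hmean, neg_zero]
    have h := (setIntegral_eq_zero_iff_of_nonneg_ae ?_ hfK.neg).1 hmeanneg
    · exact h.mono fun x hx => neg_eq_zero.1 hx
    refine (ae_restrict_mem (h₁.union h₂).measurableSet).mono fun x hx => ?_
    rcases le_total κ (f x) with h | h
    · exact neg_nonneg.2 ((hconst x hx h).le.trans hκ)
    · exact neg_nonneg.2 (h.trans hκ)
end

section
/- Let $K \subseteq [0,1]$ be compact of positive measure, $k^M = (\inf K + \sup K)/2$, $K^L = K \cap [0, k^M]$, $K^R = K \cap [k^M, 1]$. Let $f : K \to \mathbb{R}$ be continuous, mean zero, with a constant $\kappa$ such that $\lambda(f^{-1}(\{y\})) = 0$ for $y < \kappa$ and $f = \kappa$ on $\{f \geq \kappa\}$. Let $c \in (0, \min\{\lambda(K^L), \lambda(K^R)\})$ if both $\lambda(K^L), \lambda(K^R) > 0$, and $c \in (0, \lambda(K))$ otherwise. Then there exists a compact subset $E \subseteq K \cap (\inf K, \sup K)$ with $\lambda(E) = \lambda(K) - c$, $\int_E f\,d\lambda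 = 0$, and $\lambda(E \cap K^L)/\lambda(E) \in \mathbb{Q}$. -/
open MeasureTheory Set

/-- A universal chord theorem on the circle `[0, 1] / (0 ∼ 1)`: every arc length `θ` is attained by a
horizontal chord. -/
theorem exists_fract_eq_add {h : ℝ → ℝ} (hc : ContinuousOn h (Icc 0 1)) (h01 : h 0 = h 1) (θ : ℝ)
    (h0 : 0 < θ) (h1 : θ < 1) :
    ∃ a ∈ Icc (0:ℝ) 1, ∃ b ∈ Icc (0:ℝ) 1, h a = h b ∧ (b = a + θ ∨ b = a + θ - 1) := by
  have hH : Continuous (h ∘ Int.fract) := hc.comp_fract'' h01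
  obtain ⟨u, hu, hmax⟩ := isCompact_Icc.exists_isMaxOn (nonempty_Icc.2 zero_le_one) hc
  obtain ⟨v, hv, hmin⟩ := isCompact_Icc.exists_isMinOn (nonempty_Icc.2 zero_le_one) hc
  have key : ∀ x ∈ Icc (0:ℝ) 1, h (Int.fract x) = h x := by
    intro x hx
    rcases hx.2.lt_or_eq with hlt | rfl
    · rw [Int.fract_eq_self.2 ⟨hx.1, hlt⟩]
    · simp [h01]
  have hfr : ∀ x : ℝ, Int.fract x ∈ Icc (0:ℝ) 1 :=
    fun x => ⟨Int.fract_nonneg x, (Int.fract_lt_one x).le⟩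
  have hD : Continuous fun x => (h ∘ Int.fract) (x + θ) - (h ∘ Int.fract) x :=
    (hH.comp (by fun_prop)).sub hH
  obtain ⟨τ, hτ⟩ := mem_range_of_exists_le_of_exists_ge (c := 0) hD
    ⟨u, by simpa [key u hu] using hmax (hfr (u + θ))⟩
    ⟨v, by simpa [key v hv] using hmin (hfr (v + θ))⟩
  refine ⟨_, hfr τ, _, hfr (τ + θ), (sub_eq_zero.1 hτ).symm, ?_⟩
  have e1 := Int.floor_add_fract τ
  have e2 := Int.floor_add_fract (τ + θ)
  have l1 := Int.fract_lt_one τ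
  have l2 := Int.fract_lt_one (τ + θ)
  have g1 := Int.fract_nonneg τ
  have g2 := Int.fract_nonneg (τ + θ)
  have a1 : ⌊τ⌋ ≤ ⌊τ + θ⌋ := Int.floor_mono (by linarith)
  have a2 : ⌊τ + θ⌋ < ⌊τ⌋ + 2 := by
    have : (⌊τ + θ⌋ : ℝ) < ⌊τ⌋ + 2 := by linarith
    exact_mod_cast this
  have : ⌊τ + θ⌋ = ⌊τ⌋ ∨ ⌊τ + θ⌋ = ⌊τ⌋ + 1 := by omega
  rcases this with h | h
  · left; rw [h] at e2; linarith
  · right; rw [h] at e2; push_cast at e2; linarith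

theorem integrableOn_of_abs_le {f : ℝ → ℝ} (hf : Measurable f) {C : ℝ} (hC : ∀ x, |f x| ≤ C)
    {S : Set ℝ} (hS : volume S ≠ ⊤) : IntegrableOn f S :=
  Measure.integrableOn_of_bounded (M := C) hS hf.aestronglyMeasurable
    (Filter.Eventually.of_forall hC)

/-- Any proportion `θ` of a compact set is attained, for Lebesgue measure and for the integral of `f`
simultaneously, by a compact subset. -/
theorem exists_isCompact_proportional {A : Set ℝ} (hA : IsCompact A) {f : ℝ → ℝ}
    (hf : Measurable f) {C : ℝ} (hC : ∀ x, |f x| ≤ C) {θ : ℝ} (hθ : θ ∈ Icc (0 : ℝ) 1) :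
    ∃ B ⊆ A, IsCompact B ∧ volume.real B = θ * volume.real A ∧
      ∫ x in B, f x = θ * ∫ x in A, f x := by
  rcases hθ.1.eq_or_lt with rfl | h0
  · exact ⟨∅, empty_subset _, isCompact_empty, by simp, by simp⟩
  rcases hθ.2.eq_or_lt with rfl | h1
  · exact ⟨A, Subset.rfl, hA, by simp, by simp⟩
  have hfin : ∀ {S}, S ⊆ A → volume S ≠ ⊤ :=
    fun h => measure_ne_top_of_subset h hA.measure_lt_top.ne
  have hAm := hA.measurableSet
  rcases (measureReal_nonneg (μ := volume) (s := A)).eq_or_lt with hm | hm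
  · have : volume A = 0 := (measureReal_eq_zero_iff (hfin Subset.rfl)).1 hm.symm
    exact ⟨∅, empty_subset _, isCompact_empty, by simp [← hm],
      by simp [Measure.restrict_eq_zero.2 this]⟩
  set m := volume.real A
  set F : ℝ → ℝ := fun x => volume.real (A ∩ Iic x) with hF
  set G : ℝ → ℝ := fun x => ∫ t in A ∩ Iic x, f t with hG
  have hdecomp : ∀ {x y : ℝ}, x ≤ y → A ∩ Iic y = (A ∩ Iic x) ∪ (A ∩ Ioc x y) := by
    intro x y h
    rw [← inter_union_distrib_left, Iic_union_Ioc_eq_Iic h]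
  have hdisj : ∀ x y : ℝ, Disjoint (A ∩ Iic x) (A ∩ Ioc x y) := fun x y =>
    (Iic_disjoint_Ioc le_rfl).mono inter_subset_right inter_subset_right
  have hFd : ∀ {x y : ℝ}, x ≤ y → F y = F x + volume.real (A ∩ Ioc x y) := by
    intro x y h
    simp only [hF]
    rw [hdecomp h, measureReal_union (hdisj x y) (hAm.inter measurableSet_Ioc)
      (hfin inter_subset_left) (hfin inter_subset_left)]
  have hGd : ∀ {x y : ℝ}, x ≤ y → G y = G x + ∫ t in A ∩ Ioc x y, f t := by
    intro x y h
    simp only [hG]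
    rw [hdecomp h, setIntegral_union (hdisj x y) (hAm.inter measurableSet_Ioc)
      (integrableOn_of_abs_le hf hC (hfin inter_subset_left))
      (integrableOn_of_abs_le hf hC (hfin inter_subset_left))]
  have hFmono : Monotone F := fun x y h => by
    rw [hFd h]; linarith [measureReal_nonneg (μ := volume) (s := A ∩ Ioc x y)]
  have hFlip : ∀ {x y : ℝ}, x ≤ y → F y - F x ≤ y - x := by
    intro x y h
    rw [hFd h, add_sub_cancel_left]
    calc _ ≤ volume.real (Ioc x y) := measureReal_mono inter_subset_right (by simp)
      _ = y - x := by simp [measureReal_def, h]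
  have hFcont : Continuous F := by
    refine (LipschitzWith.of_dist_le_mul (K := 1) fun x y => ?_).continuous
    rw [Real.dist_eq, Real.dist_eq, NNReal.coe_one, one_mul]
    rcases le_total x y with h | h
    · rw [abs_sub_comm, abs_sub_comm x, abs_of_nonneg (sub_nonneg.2 (hFmono h)),
        abs_of_nonneg (sub_nonneg.2 h)]
      exact hFlip h
    · rw [abs_of_nonneg (sub_nonneg.2 (hFmono h)), abs_of_nonneg (sub_nonneg.2 h)]
      exact hFlip h
  have hGlip : ∀ {x y : ℝ}, x ≤ y → |G y - G x| ≤ C * (F y - F x) := by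
    intro x y h
    rw [hGd h, hFd h, add_sub_cancel_left, add_sub_cancel_left]
    exact norm_setIntegral_le_of_norm_le_const (f := f) (hfin inter_subset_left).lt_top
      fun t _ => hC t
  have hGlip' : ∀ x y : ℝ, |G x - G y| ≤ C * |F x - F y| := by
    intro x y
    rcases le_total x y with h | h
    · rw [abs_sub_comm, abs_sub_comm (F x), abs_of_nonneg (sub_nonneg.2 (hFmono h))]
      exact hGlip h
    · rw [abs_of_nonneg (sub_nonneg.2 (hFmono h))]
      exact hGlip h
  obtain ⟨α, hα⟩ := hA.bddBelow
  obtain ⟨β, hβ⟩ := hA.bddAbove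
  have hα' : A ∩ Iic (α - 1) = ∅ := by
    ext x; simp only [mem_inter_iff, mem_Iic, mem_empty_iff_false, iff_false, not_and, not_le]
    intro hx; linarith [hα hx]
  have hβ' : A ∩ Iic β = A := inter_eq_left.2 fun x hx => hβ hx
  have hFα : F (α - 1) = 0 := by simp [hF, hα']
  have hFβ : F β = m := by simp [hF, hβ', m]
  have hαβ : α - 1 ≤ β := by
    by_contra! h
    have := hFmono h.le
    linarith
  have hsurj : ∀ s : ℝ, ∃ x, s ∈ Icc (0 : ℝ) 1 → F x = s * m := by
    intro s
    by_cases hs : s ∈ Icc (0 : ℝ) 1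
    · obtain ⟨x, -, hx⟩ := intermediate_value_Icc hαβ hFcont.continuousOn
        (show s * m ∈ Icc (F (α - 1)) (F β) by
          rw [hFα, hFβ]; exact ⟨mul_nonneg hs.1 hm.le, mul_le_of_le_one_left hm.le hs.2⟩)
      exact ⟨x, fun _ => hx⟩
    · exact ⟨0, fun h => absurd h hs⟩
  choose ψ hψ using hsurj
  set I := ∫ t in A, f t
  have hGα : G (α - 1) = 0 := by simp [hG, hα']
  have hGβ : G β = I := by simp [hG, hβ', I]
  have hG0 : G (ψ 0) = 0 := by
    have := hGlip' (ψ 0) (α - 1)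
    rw [hGα, hFα, hψ 0 (by simp)] at this
    simpa using this
  have hG1 : G (ψ 1) = I := by
    have := hGlip' (ψ 1) β
    rw [hGβ, hFβ, hψ 1 (by simp)] at this
    simpa [sub_eq_zero] using this
  have hcont : ContinuousOn (fun s => G (ψ s) - s * I) (Icc 0 1) := by
    refine ContinuousOn.sub ?_ (by fun_prop)
    refine (LipschitzOnWith.of_dist_le_mul (K := (C * m).toNNReal)
      fun s hs t ht => ?_).continuousOn
    have := hGlip' (ψ s) (ψ t)
    rw [hψ s hs, hψ t ht, ← sub_mul, abs_mul, abs_of_pos hm] at this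
    rw [Real.dist_eq, Real.dist_eq]
    refine this.trans ?_
    calc _ = C * m * |s - t| := by ring
      _ ≤ _ := mul_le_mul_of_nonneg_right (Real.le_coe_toNNReal _) (abs_nonneg _)
  obtain ⟨a, ha, b, hb, hab, hcase⟩ := exists_fract_eq_add hcont (by simp [hG0, hG1]) θ h0 h1
  have hlt : ∀ {s t}, s ∈ Icc (0:ℝ) 1 → t ∈ Icc (0:ℝ) 1 → s < t → ψ s ≤ ψ t := by
    intro s t hs ht hst
    by_contra! h
    have := hFmono h.le
    rw [hψ s hs, hψ t ht] at this
    nlinarith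
  rcases hcase with hba | hba
  · have hle := hlt ha hb (by linarith)
    have hae : (A ∩ Icc (ψ a) (ψ b) : Set ℝ) =ᵐ[volume] (A ∩ Ioc (ψ a) (ψ b) : Set ℝ) :=
      (ae_eq_refl A).inter Ioc_ae_eq_Icc.symm
    refine ⟨A ∩ Icc (ψ a) (ψ b), inter_subset_left, hA.inter_right isClosed_Icc, ?_, ?_⟩
    · rw [measureReal_congr hae]
      have := hFd hle
      rw [hψ a ha, hψ b hb] at this
      linear_combination m * hba - this
    · rw [setIntegral_congr_set hae]
      linear_combination I * hba - hGd hle - hab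
  · have hle := hlt hb ha (by linarith)
    have hae : (A \ Ioo (ψ b) (ψ a) : Set ℝ) =ᵐ[volume] (A \ (A ∩ Ioc (ψ b) (ψ a)) : Set ℝ) := by
      rw [sdiff_self_inter]
      exact (ae_eq_refl A).diff Ioo_ae_eq_Ioc
    refine ⟨A \ Ioo (ψ b) (ψ a), sdiff_subset, hA.diff isOpen_Ioo, ?_, ?_⟩
    · rw [measureReal_congr hae, measureReal_sdiff inter_subset_left
        (hAm.inter measurableSet_Ioc) (hfin Subset.rfl)]
      have := hFd hle
      rw [hψ a ha, hψ b hb] at this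
      linear_combination m * hba + this
    · rw [setIntegral_congr_set hae, setIntegral_sdiff (hAm.inter measurableSet_Ioc)
        (integrableOn_of_abs_le hf hC (hfin Subset.rfl)) inter_subset_left]
      linear_combination I * hba + hGd hle - hab

theorem exists_isCompact_approx {S : Set ℝ} (hS : MeasurableSet S) (hfin : volume S ≠ ⊤)
    {f : ℝ → ℝ} (hf : Measurable f) {C : ℝ} (hC : ∀ x, |f x| ≤ C) {δ : ℝ} (hδ : 0 < δ) :
    ∃ R ⊆ S, IsCompact R ∧ |volume.real S - volume.real R| ≤ δ ∧
      |(∫ x in S, f x) - ∫ x in R, f x| ≤ C * δ := by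
  obtain ⟨R, hRS, hR, hlt⟩ := hS.exists_isCompact_sdiff_lt hfin
    (ε := ENNReal.ofReal δ) (by simpa using hδ)
  have hfin' : volume (S \ R) ≠ ⊤ := measure_ne_top_of_subset sdiff_subset hfin
  have hle : volume.real (S \ R) ≤ δ := ENNReal.toReal_le_of_le_ofReal hδ.le hlt.le
  refine ⟨R, hRS, hR, ?_, ?_⟩
  · rw [← measureReal_sdiff hRS hR.measurableSet hfin,
      abs_of_nonneg measureReal_nonneg]
    exact hle
  · rw [← setIntegral_sdiff hR.measurableSet (integrableOn_of_abs_le hf hC hfin) hRS]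
    exact (norm_setIntegral_le_of_norm_le_const (f := f) hfin'.lt_top fun x _ => hC x).trans
      (mul_le_mul_of_nonneg_left hle ((abs_nonneg _).trans (hC 0)))

theorem exists_isCompact_setIntegral_lt {S : Set ℝ} (hS : MeasurableSet S)
    {f : ℝ → ℝ} (hf : Measurable f) {C : ℝ} (hC : ∀ x, |f x| ≤ C) {s : ℝ}
    (hpos : 0 < volume (S ∩ {x | f x < s})) :
    ∃ P ⊆ S ∩ {x | f x < s}, IsCompact P ∧ 0 < volume.real P ∧
      ∫ x in P, f x < s * volume.real P := by
  obtain ⟨P, hPS, hP, hlt⟩ :=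
    (hS.inter (measurableSet_lt hf measurable_const)).exists_lt_isCompact hpos
  have hPfin := (hP.measure_lt_top (μ := volume)).ne
  have hint := integrableOn_of_abs_le hf hC hPfin
  have hcint : IntegrableOn (fun _ => s) P := integrableOn_const hPfin
  refine ⟨P, hPS, hP, ENNReal.toReal_pos hlt.ne' hPfin, ?_⟩
  have h : 0 < ∫ x in P, (s - f x) := by
    rw [setIntegral_pos_iff_support_of_nonneg_ae (f := fun x => s - f x) _ (hcint.sub hint)]
    · refine hlt.trans_le (measure_mono fun x hx => ⟨?_, hx⟩)
      exact (sub_pos.2 (hPS hx).2).ne'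
    · exact (ae_restrict_iff' hP.measurableSet).2
        (Filter.Eventually.of_forall fun x hx => (sub_pos.2 (hPS hx).2).le)
  rw [integral_sub hcint hint, setIntegral_const, smul_eq_mul] at h
  linarith

theorem exists_small_solution {p q i j s τ : ℝ} (hp : 0 < p) (hq : 0 < q) (hi : i < s * p)
    (hj : s * q < j) (hτ : 0 < τ) :
    ∃ η > 0, ∀ x y : ℝ, |x| ≤ η → |y| ≤ η →
      ∃ α β : ℝ, p * α + q * β = x ∧ i * α + j * β = y ∧ |α| ≤ τ ∧ |β| ≤ τ := by
  have hD : 0 < p * j - q * i := by nlinarith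
  set D := p * j - q * i
  set N := |i| + |j| + p + q
  have hN : 0 < N := by positivity
  refine ⟨D * τ / N, by positivity, fun x y hx hy =>
    ⟨(x * j - q * y) / D, (p * y - i * x) / D, ?_, ?_, ?_, ?_⟩⟩
  · field_simp; simp only [D]; ring
  · field_simp; simp only [D]; ring
  · rw [abs_div, abs_of_pos hD, div_le_iff₀ hD]
    calc _ ≤ |x * j| + |q * y| := abs_sub _ _
      _ = |x| * |j| + q * |y| := by rw [abs_mul, abs_mul, abs_of_pos hq]
      _ ≤ D * τ / N * |j| + q * (D * τ / N) := by gcongr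
      _ = (|j| + q) * (D * τ / N) := by ring
      _ ≤ N * (D * τ / N) := by
        gcongr
        simp only [N]; linarith [abs_nonneg i]
      _ = τ * D := by field_simp
  · rw [abs_div, abs_of_pos hD, div_le_iff₀ hD]
    calc _ ≤ |p * y| + |i * x| := abs_sub _ _
      _ = p * |y| + |i| * |x| := by rw [abs_mul, abs_mul, abs_of_pos hp]
      _ ≤ p * (D * τ / N) + |i| * (D * τ / N) := by gcongr
      _ = (p + |i|) * (D * τ / N) := by ring
      _ ≤ N * (D * τ / N) := by
        gcongr
        simp only [N]; linarith [abs_nonneg j]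
      _ = τ * D := by field_simp

/-- Some number near `t` has a rational product with `m`. -/
theorem exists_near_mul_eq_rat (t m : ℝ) {ε : ℝ} (hε : 0 < ε) (hm : 0 ≤ m) :
    ∃ γ : ℝ, |γ| ≤ ε ∧ ∃ q : ℚ, (t + γ) * m = q := by
  rcases hm.eq_or_lt with rfl | hm
  · exact ⟨0, by simpa using hε.le, 0, by simp⟩
  obtain ⟨q, h1, h2⟩ := exists_rat_btwn (show t * m < (t + ε) * m by nlinarith)
  refine ⟨q / m - t, ?_, q, by field_simp; ring⟩
  have h1' : t < q / m := by rwa [lt_div_iff₀ hm]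
  have h2' : q / m < t + ε := by rwa [div_lt_iff₀ hm]
  rw [abs_of_pos (by linarith)]
  linarith

theorem exists_isCompact_measureReal_eq_and_ratio_rat {A B : Set ℝ} (hA : MeasurableSet A)
    (hB : MeasurableSet B) (hAB : Disjoint A B) (hAfin : volume A ≠ ⊤) (hBfin : volume B ≠ ⊤)
    {M : ℝ} (hM : 0 < M) (hM' : M < volume.real A + volume.real B) :
    ∃ E ⊆ A ∪ B, IsCompact E ∧ volume.real E = M ∧
      ∃ q : ℚ, volume.real (E ∩ A) / volume.real E = q := by
  have hz : ∀ x : ℝ, |(fun _ => 0 : ℝ → ℝ) x| ≤ 0 := by simp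
  have hδ : 0 < (volume.real A + volume.real B - M) / 3 := by linarith
  obtain ⟨A', hA', hA'c, hA'm, -⟩ := exists_isCompact_approx hA hAfin measurable_const hz hδ
  obtain ⟨B', hB', hB'c, hB'm, -⟩ := exists_isCompact_approx hB hBfin measurable_const hz hδ
  have hsum : M < volume.real A' + volume.real B' := by
    linarith [(abs_le.1 hA'm).2, (abs_le.1 hB'm).2]
  have ha := measureReal_nonneg (μ := volume) (s := A')
  have hb := measureReal_nonneg (μ := volume) (s := B')
  set a := volume.real A'
  set b := volume.real B'
  obtain ⟨q, hq0, hq1, hqa, hqb⟩ : ∃ q : ℚ, 0 ≤ (q : ℝ) ∧ (q : ℝ) ≤ 1 ∧ q * M ≤ a ∧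
      (1 - q) * M ≤ b := by
    rcases ha.eq_or_lt with ha | ha
    · exact ⟨0, by simp, by simp, by simp [← ha], by simp; linarith⟩
    rcases hb.eq_or_lt with hb | hb
    · exact ⟨1, by simp, by simp, by simp; linarith, by simp [← hb]⟩
    obtain ⟨q, h1, h2⟩ := exists_rat_btwn (show max 0 (1 - b / M) < min 1 (a / M) by
      have : 1 < a / M + b / M := by rw [← add_div, one_lt_div hM]; exact hsum
      have h1 : 0 < a / M := by positivity
      have h2 : 0 < b / M := by positivity
      simp only [max_lt_iff, lt_min_iff]
      refine ⟨⟨one_pos, ?_⟩, ?_, ?_⟩ <;> linarith)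
    rw [max_lt_iff] at h1
    rw [lt_min_iff, lt_div_iff₀ hM] at h2
    refine ⟨q, h1.1.le, h2.1.le, h2.2.le, ?_⟩
    have : 1 - q ≤ b / M := by linarith
    rwa [le_div_iff₀ hM] at this
  have key : ∀ {S : Set ℝ} {r : ℝ}, IsCompact S → 0 ≤ r → r ≤ volume.real S →
      ∃ T ⊆ S, IsCompact T ∧ volume.real T = r := by
    intro S r hS h0 hr
    obtain ⟨T, hT, hTc, hTm, -⟩ := exists_isCompact_proportional hS measurable_const hz
      (θ := r / volume.real S) ⟨by positivity, div_le_one_of_le₀ hr measureReal_nonneg⟩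
    refine ⟨T, hT, hTc, hTm.trans (div_mul_cancel_of_imp fun h => ?_)⟩
    exact le_antisymm (h ▸ hr) h0
  obtain ⟨S, hS, hSc, hSm⟩ := key hA'c (by positivity) hqa
  obtain ⟨T, hT, hTc, hTm⟩ := key hB'c (mul_nonneg (by linarith) hM.le) hqb
  have hd : Disjoint S T := hAB.mono (hS.trans hA') (hT.trans hB')
  have hE : volume.real (S ∪ T) = M := by
    rw [measureReal_union hd hTc.measurableSet hSc.measure_lt_top.ne hTc.measure_lt_top.ne,
      hSm, hTm]
    ring
  have hEA : (S ∪ T) ∩ A = S := by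
    rw [union_inter_distrib_right, inter_eq_left.2 (hS.trans hA'),
      (hAB.symm.mono_left (hT.trans hB')).inter_eq, union_empty]
  refine ⟨S ∪ T, union_subset_union (hS.trans hA') (hT.trans hB'), hSc.union hTc, hE, q, ?_⟩
  rw [hEA, hE, hSm, mul_div_cancel_right₀ _ hM.ne']

/-- If `f` has mean zero on `A ∪ B` and is not almost everywhere constant on `A`, then compact subsets
of `A ∪ B` of any intermediate measure can be chosen with mean zero and with rational proportions in
`A` and `B`. -/
theorem exists_isCompact_setIntegral_eq_zero {A B : Set ℝ} (hA : MeasurableSet A)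
    (hB : MeasurableSet B) (hAB : Disjoint A B) (hAfin : volume A ≠ ⊤) (hBfin : volume B ≠ ⊤)
    {f : ℝ → ℝ} (hf : Measurable f) {C : ℝ} (hC : ∀ x, |f x| ≤ C)
    (hmean : (∫ x in A, f x) + ∫ x in B, f x = 0) {s : ℝ}
    (hlt : 0 < volume (A ∩ {x | f x < s})) (hgt : 0 < volume (A ∩ {x | s < f x}))
    {M : ℝ} (hM : 0 < M) (hM' : M < volume.real A + volume.real B) :
    ∃ E ⊆ A ∪ B, IsCompact E ∧ volume.real E = M ∧ ∫ x in E, f x = 0 ∧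
      (∃ q : ℚ, volume.real (E ∩ A) / volume.real E = q) ∧
      ∃ q : ℚ, volume.real (E ∩ B) / volume.real E = q := by
  obtain ⟨P, hPA, hPc, hPpos, hPint⟩ := exists_isCompact_setIntegral_lt hA hf hC hlt
  obtain ⟨Q, hQA, hQc, hQpos, hQint⟩ := exists_isCompact_setIntegral_lt hA hf.neg
    (C := C) (by simpa using hC) (s := -s) (by simpa using hgt)
  have hQint : s * volume.real Q < ∫ x in Q, f x := by
    simp only [Pi.neg_apply, integral_neg] at hQint
    linarith
  have hPQ : Disjoint P Q := by
    refine disjoint_left.2 fun x hP hQ => ?_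
    have h1 : f x < s := (hPA hP).2
    have h2 : -f x < -s := (hQA hQ).2
    linarith
  replace hPA : P ⊆ A := hPA.trans inter_subset_left
  replace hQA : Q ⊆ A := hQA.trans inter_subset_left
  have hPQm : MeasurableSet (P ∪ Q) := hPc.measurableSet.union hQc.measurableSet
  have hPQA : P ∪ Q ⊆ A := union_subset hPA hQA
  have hPfin := (hPc.measure_lt_top (μ := volume)).ne
  have hQfin := (hQc.measure_lt_top (μ := volume)).ne
  have hint : ∀ {S : Set ℝ}, volume S ≠ ⊤ → IntegrableOn f S := integrableOn_of_abs_le hf hC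
  set A₀ := A \ (P ∪ Q) with hA₀
  have hA₀fin : volume A₀ ≠ ⊤ := measure_ne_top_of_subset sdiff_subset hAfin
  have hmA : volume.real A = volume.real P + volume.real Q + volume.real A₀ := by
    rw [hA₀, measureReal_sdiff hPQA hPQm hAfin,
      measureReal_union hPQ hQc.measurableSet hPfin hQfin]
    ring
  have hiA : ∫ x in A, f x =
      (∫ x in P, f x) + (∫ x in Q, f x) + ∫ x in A₀, f x := by
    rw [hA₀, setIntegral_sdiff hPQm (hint hAfin) hPQA,
      setIntegral_union hPQ hQc.measurableSet (hint hPfin) (hint hQfin)]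
    ring
  have htot : 0 < volume.real A + volume.real B := hM.trans hM'
  obtain ⟨t, ht0, ht1, htM⟩ :
      ∃ t : ℝ, 0 < t ∧ t < 1 ∧ t * (volume.real A + volume.real B) = M :=
    ⟨_, div_pos hM htot, (div_lt_one htot).2 hM', div_mul_cancel₀ _ htot.ne'⟩
  have hτ : 0 < min t (1 - t) := lt_min ht0 (by linarith)
  have hmem : ∀ {γ : ℝ}, |γ| ≤ min t (1 - t) → t + γ ∈ Icc (0 : ℝ) 1 := by
    intro γ hγ
    obtain ⟨h1, h2⟩ := le_min_iff.1 hγ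
    exact ⟨by linarith [(abs_le.1 h1).1], by linarith [(abs_le.1 h2).2]⟩
  obtain ⟨η, hη, hsol⟩ := exists_small_solution hPpos hQpos hPint hQint hτ
  have hC0 : 0 ≤ C := (abs_nonneg _).trans (hC 0)
  set δ := η / (4 * (C + 1)) with hδ
  have hδpos : 0 < δ := by positivity
  have hδη : 4 * δ ≤ η ∧ 4 * (C * δ) ≤ η := by
    have : η = 4 * (C + 1) * δ := by rw [hδ]; field_simp
    constructor <;> nlinarith
  obtain ⟨R, hR, hRc, hRm, hRi⟩ :=
    exists_isCompact_approx (hA.diff hPQm) hA₀fin hf hC hδpos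
  obtain ⟨U, hU, hUc, hUm, hUi⟩ := exists_isCompact_approx hB hBfin hf hC hδpos
  set mU := volume.real U
  set iU := ∫ x in U, f x
  have hmU0 : 0 ≤ mU := measureReal_nonneg
  set W := mU + |iU| + 1 with hW
  have hWpos : 0 < W := by positivity
  obtain ⟨γ, hγ, q, hq⟩ := exists_near_mul_eq_rat t (mU / M)
    (ε := min (min t (1 - t)) (η / 2 / W)) (lt_min hτ (by positivity)) (by positivity)
  obtain ⟨hγτ, hγη⟩ := le_min_iff.1 hγ
  have hγW : |γ| * W ≤ η / 2 := by rwa [le_div_iff₀ hWpos] at hγη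
  have hγm : |γ * mU| ≤ η / 2 := by
    rw [abs_mul, abs_of_nonneg hmU0]
    exact (mul_le_mul_of_nonneg_left (by linarith [abs_nonneg iU]) (abs_nonneg γ)).trans hγW
  have hγi : |γ * iU| ≤ η / 2 := by
    rw [abs_mul]
    exact (mul_le_mul_of_nonneg_left (by linarith) (abs_nonneg γ)).trans hγW
  have hbound : ∀ {u v w e : ℝ}, |u| ≤ e → |v| ≤ e → 4 * e ≤ η → |w| ≤ η / 2 →
      |t * u + t * v - w| ≤ η := by
    intro u v w e hu hv he hw
    have key : ∀ {z : ℝ}, |z| ≤ e → |t * z| ≤ e := fun {z} hz => by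
      rw [abs_mul, abs_of_pos ht0]
      exact (mul_le_of_le_one_left (abs_nonneg z) ht1.le).trans hz
    linarith [abs_sub (t * u + t * v) w, abs_add_le (t * u) (t * v), key hu, key hv]
  obtain ⟨α, β, hx, hy, hα, hβ⟩ := hsol _ _ (hbound hRm hUm hδη.1 hγm)
    (hbound hRi hUi hδη.2 hγi)
  obtain ⟨P', hP', hP'c, hP'm, hP'i⟩ := exists_isCompact_proportional hPc hf hC (hmem hα)
  obtain ⟨Q', hQ', hQ'c, hQ'm, hQ'i⟩ := exists_isCompact_proportional hQc hf hC (hmem hβ)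
  obtain ⟨R', hR', hR'c, hR'm, hR'i⟩ :=
    exists_isCompact_proportional hRc hf hC (θ := t) ⟨ht0.le, ht1.le⟩
  obtain ⟨U', hU', hU'c, hU'm, hU'i⟩ := exists_isCompact_proportional hUc hf hC (hmem hγτ)
  have hd1 : Disjoint P' Q' := hPQ.mono hP' hQ'
  have hd2 : Disjoint (P' ∪ Q') R' :=
    disjoint_sdiff_right.mono (union_subset_union hP' hQ') (hR'.trans hR)
  have hUB : U' ⊆ B := hU'.trans hU
  have hPQRA : P' ∪ Q' ∪ R' ⊆ A := union_subset
    ((union_subset_union hP' hQ').trans hPQA) ((hR'.trans hR).trans sdiff_subset)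
  have hd3 : Disjoint (P' ∪ Q' ∪ R') U' := hAB.mono hPQRA hUB
  have c2 := hP'c.union hQ'c
  have c3 := c2.union hR'c
  have fin : ∀ {S : Set ℝ}, IsCompact S → volume S ≠ ⊤ := fun h => h.measure_lt_top.ne
  have hE3 : volume.real (P' ∪ Q' ∪ R') + volume.real U' = M := by
    rw [measureReal_union hd2 hR'c.measurableSet (fin c2) (fin hR'c),
      measureReal_union hd1 hQ'c.measurableSet (fin hP'c) (fin hQ'c), hP'm, hQ'm, hR'm, hU'm]
    linear_combination hx + htM - t * hmA
  have hE : volume.real (P' ∪ Q' ∪ R' ∪ U') = M := by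
    rw [measureReal_union hd3 hU'c.measurableSet (fin c3) (fin hU'c), hE3]
  have hEA : (P' ∪ Q' ∪ R' ∪ U') ∩ A = P' ∪ Q' ∪ R' := by
    rw [union_inter_distrib_right, inter_eq_left.2 hPQRA,
      (hAB.symm.mono_left hUB).inter_eq, union_empty]
  have hEB : (P' ∪ Q' ∪ R' ∪ U') ∩ B = U' := by
    rw [union_inter_distrib_right, inter_eq_left.2 hUB,
      (hAB.mono_left hPQRA).inter_eq, empty_union]
  have hUq : volume.real U' / M = q := by rw [hU'm, ← hq]; ring
  refine ⟨P' ∪ Q' ∪ R' ∪ U', union_subset_union hPQRA hUB, c3.union hU'c, hE, ?_,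
    ⟨1 - q, ?_⟩, ⟨q, by rw [hEB, hE, hUq]⟩⟩
  · rw [setIntegral_union hd3 hU'c.measurableSet (hint (fin c3)) (hint (fin hU'c)),
      setIntegral_union hd2 hR'c.measurableSet (hint (fin c2)) (hint (fin hR'c)),
      setIntegral_union hd1 hQ'c.measurableSet (hint (fin hP'c)) (hint (fin hQ'c)),
      hP'i, hQ'i, hR'i, hU'i]
    linear_combination hy + t * hmean - t * hiA
  · rw [hEA, hE, eq_sub_of_add_eq hE3, sub_div, div_self hM.ne', hUq]
    push_cast
    ring

theorem exists_measure_inter_ne_eq_zero {S : Set ℝ} {f : ℝ → ℝ} {C : ℝ} (hC : ∀ x, |f x| ≤ C)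
    (hpos : 0 < volume S)
    (h : ∀ s, volume (S ∩ {x | f x < s}) = 0 ∨ volume (S ∩ {x | s < f x}) = 0) :
    ∃ d, volume (S ∩ {x | f x ≠ d}) = 0 := by
  set Z := {s | volume (S ∩ {x | f x < s}) = 0} with hZ
  have hne : Z.Nonempty := ⟨-C, by
    have : S ∩ {x | f x < -C} = ∅ := by
      ext x
      simpa using fun _ => (abs_le.1 (hC x)).1
    simp [hZ, this]⟩
  have hbdd : BddAbove Z := by
    refine ⟨C, fun s hs => ?_⟩
    by_contra! hlt
    have : S ∩ {x | f x < s} = S :=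
      inter_eq_left.2 fun x _ => ((abs_le.1 (hC x)).2.trans_lt hlt)
    rw [hZ, mem_ofPred_eq, this] at hs
    exact hpos.ne' hs
  refine ⟨sSup Z, ?_⟩
  have hsub : S ∩ {x | f x ≠ sSup Z} ⊆
      (⋃ r : {r : ℚ // (r : ℝ) < sSup Z}, S ∩ {x | f x < r.1}) ∪
      ⋃ r : {r : ℚ // sSup Z < (r : ℝ)}, S ∩ {x | (r.1 : ℝ) < f x} := by
    rintro x ⟨hxS, hx⟩
    rcases lt_or_gt_of_ne hx with hx | hx
    · obtain ⟨r, h1, h2⟩ := exists_rat_btwn hx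
      exact Or.inl (mem_iUnion.2 ⟨⟨r, h2⟩, hxS, h1⟩)
    · obtain ⟨r, h1, h2⟩ := exists_rat_btwn hx
      exact Or.inr (mem_iUnion.2 ⟨⟨r, h1⟩, hxS, h2⟩)
  refine measure_mono_null hsub (measure_union_null (measure_iUnion_null fun r => ?_)
    (measure_iUnion_null fun r => ?_))
  · obtain ⟨s, hs, hrs⟩ := exists_lt_of_lt_csSup hne r.2
    exact measure_mono_null (inter_subset_inter_right _ fun x hx => lt_trans hx hrs) hs
  · exact (h r.1).resolve_left fun hr => (le_csSup hbdd hr).not_gt r.2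

theorem exists_separating_level_or_measure_ne_eq_zero {K S : Set ℝ} (hSK : S ⊆ K) {f g : ℝ → ℝ}
    (hgf : EqOn g f K) {C : ℝ} (hC : ∀ x, |g x| ≤ C) {κ : ℝ}
    (hlevel : ∀ y < κ, volume (K ∩ f ⁻¹' {y}) = 0) (hconst : ∀ x ∈ K, κ ≤ f x → f x = κ) :
    (∃ s, 0 < volume (S ∩ {x | g x < s}) ∧ 0 < volume (S ∩ {x | s < g x})) ∨
      volume (S ∩ {x | g x ≠ κ}) = 0 := by
  rw [or_iff_not_imp_left]
  intro hs
  rcases eq_zero_or_pos (volume S) with h0 | hpos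
  · exact measure_mono_null inter_subset_left h0
  obtain ⟨d, hd⟩ := exists_measure_inter_ne_eq_zero hC hpos (by
    intro s
    by_contra! h
    exact hs ⟨s, pos_iff_ne_zero.2 h.1, pos_iff_ne_zero.2 h.2⟩)
  have hcover : S ⊆ (S ∩ {x | g x ≠ d}) ∪ (K ∩ f ⁻¹' {d}) := by
    intro x hx
    by_cases h : g x = d
    · exact Or.inr ⟨hSK hx, (hgf (hSK hx)).symm.trans h⟩
    · exact Or.inl ⟨hx, h⟩
  have hne : volume (K ∩ f ⁻¹' {d}) ≠ 0 := fun h =>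
    hpos.ne' (measure_mono_null hcover (measure_union_null hd h))
  obtain ⟨x, hxK, hx⟩ := nonempty_of_measure_ne_zero hne
  have hx : f x = d := hx
  have hκd : κ ≤ d := not_lt.1 fun h => hne (hlevel d h)
  rw [← hconst x hxK (hx ▸ hκd), hx]
  exact hd

theorem stmt8 (K : Set ℝ) (hK : IsCompact K) (hK1 : K ⊆ Set.Icc 0 1)
    (hKpos : 0 < volume K)
    (KL KR : Set ℝ)
    (hKL : KL = K ∩ Set.Icc 0 ((sInf K + sSup K) / 2))
    (hKR : KR = K ∩ Set.Icc ((sInf K + sSup K) / 2) 1)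
    (f : ℝ → ℝ) (hcont : ContinuousOn f K) (hmean : ∫ x in K, f x = 0)
    (κ : ℝ) (hlevel : ∀ y < κ, volume (K ∩ f ⁻¹' {y}) = 0)
    (hconst : ∀ x ∈ K, κ ≤ f x → f x = κ)
    (c : ℝ)
    (hc : if 0 < volume KL ∧ 0 < volume KR
      then c ∈ Set.Ioo 0 (min (volume KL).toReal (volume KR).toReal)
      else c ∈ Set.Ioo 0 (volume K).toReal) :
    ∃ E : Set ℝ, IsCompact E ∧ E ⊆ K ∩ Set.Ioo (sInf K) (sSup K) ∧
      (volume E).toReal = (volume K).toReal - c ∧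
      (∫ x in E, f x) = 0 ∧
      ∃ q : ℚ, (volume (E ∩ KL)).toReal / (volume E).toReal = (q : ℝ) := by
  have hKfin := (hK.measure_lt_top (μ := volume)).ne
  have hKm := hK.measurableSet
  have hcK : 0 < c ∧ c < volume.real K := by
    split_ifs at hc with h
    · refine ⟨hc.1, (hc.2.trans_le (min_le_left _ _)).trans_le ?_⟩
      exact measureReal_mono (hKL ▸ inter_subset_left) hKfin
    · exact hc
  obtain ⟨C, hC⟩ := hK.exists_bound_of_continuousOn hcont
  obtain ⟨x₀, hx₀⟩ := nonempty_of_measure_ne_zero hKpos.ne'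
  have hinf : ∀ x ∈ K, sInf K ≤ x := fun x hx => csInf_le hK.bddBelow hx
  have hsup : ∀ x ∈ K, x ≤ sSup K := fun x hx => le_csSup hK.bddAbove hx
  have hab : sInf K ≤ sSup K := (hinf x₀ hx₀).trans (hsup x₀ hx₀)
  set a := sInf K
  set b := sSup K
  set m := (a + b) / 2 with hm
  obtain ⟨g, hgm, hgC, hgf⟩ : ∃ g : ℝ → ℝ, Measurable g ∧ (∀ x, |g x| ≤ C) ∧ EqOn g f K := by
    refine ⟨K.indicator f, ?_, fun x => ?_, fun x hx => indicator_of_mem hx f⟩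
    · classical
      rw [← piecewise_eq_indicator]
      exact hcont.measurable_piecewise continuousOn_const hKm
    · by_cases hx : x ∈ K
      · rw [indicator_of_mem hx]; exact hC x hx
      · rw [indicator_of_notMem hx, abs_zero]
        exact (norm_nonneg _).trans (hC x₀ hx₀)
  set A := K ∩ Ioo a m with hA
  set B := K ∩ Ioo m b with hB
  have hAm : MeasurableSet A := hKm.inter measurableSet_Ioo
  have hBm : MeasurableSet B := hKm.inter measurableSet_Ioo
  have hAfin : volume A ≠ ⊤ := measure_ne_top_of_subset inter_subset_left hKfin
  have hBfin : volume B ≠ ⊤ := measure_ne_top_of_subset inter_subset_left hKfin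
  have hAB : Disjoint A B := by
    refine disjoint_left.2 fun x hx hy => ?_
    exact lt_asymm hx.2.2 hy.2.1
  have hsub : A ∪ B ⊆ K ∩ Ioo a b := by
    rintro x (⟨hxK, h1, h2⟩ | ⟨hxK, h1, h2⟩)
    · exact ⟨hxK, h1, by linarith⟩
    · exact ⟨hxK, by linarith, h2⟩
  have hne : ∀ y : ℝ, ∀ᵐ x, x ≠ y := fun y => by simp [ae_iff]
  have hKAB : K =ᵐ[volume] (A ∪ B : Set ℝ) := by
    filter_upwards [hne a, hne m, hne b] with x ha hm hb
    refine propext ⟨fun hx => ?_, fun hx => (hsub hx).1⟩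
    rcases lt_or_gt_of_ne hm with h | h
    · exact Or.inl ⟨hx, (hinf x hx).lt_of_ne' ha, h⟩
    · exact Or.inr ⟨hx, h, (hsup x hx).lt_of_ne hb⟩
  have hKLA : KL =ᵐ[volume] A := by
    filter_upwards [hne a, hne m] with x ha hm
    rw [hKL]
    refine propext ⟨fun hx => ⟨hx.1, (hinf x hx.1).lt_of_ne' ha, hx.2.2.lt_of_ne hm⟩,
      fun hx => ⟨hx.1, (hK1 hx.1).1, hx.2.2.le⟩⟩
  have hmeas : volume.real K = volume.real A + volume.real B := by
    rw [measureReal_congr hKAB, measureReal_union hAB hBm hAfin hBfin]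
  have hgmean : (∫ x in A, g x) + ∫ x in B, g x = 0 := by
    rw [← setIntegral_union hAB hBm (integrableOn_of_abs_le hgm hgC hAfin)
      (integrableOn_of_abs_le hgm hgC hBfin), ← setIntegral_congr_set hKAB,
      setIntegral_congr_fun hKm hgf, hmean]
  have hM : 0 < volume.real K - c := by linarith
  have hM' : volume.real K - c < volume.real A + volume.real B := by linarith
  suffices h : ∃ E ⊆ A ∪ B, IsCompact E ∧ volume.real E = volume.real K - c ∧
      ∫ x in E, g x = 0 ∧ ∃ q : ℚ, volume.real (E ∩ A) / volume.real E = q by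
    obtain ⟨E, hE, hEc, hEm, hEi, q, hq⟩ := h
    have hEK := hE.trans hsub
    refine ⟨E, hEc, hEK, hEm, ?_, q, ?_⟩
    · rw [← hEi]
      exact setIntegral_congr_fun hEc.measurableSet fun x hx => (hgf (hEK hx).1).symm
    · rw [measure_congr ((ae_eq_refl E).inter hKLA)]
      exact hq
  rcases exists_separating_level_or_measure_ne_eq_zero (S := A) inter_subset_left hgf hgC
    hlevel hconst with ⟨s, hlt, hgt⟩ | hA0
  · obtain ⟨E, hE, hEc, hEm, hEi, hq, -⟩ := exists_isCompact_setIntegral_eq_zero hAm hBm hAB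
      hAfin hBfin hgm hgC hgmean hlt hgt hM hM'
    exact ⟨E, hE, hEc, hEm, hEi, hq⟩
  rcases exists_separating_level_or_measure_ne_eq_zero (S := B) inter_subset_left hgf hgC
    hlevel hconst with ⟨s, hlt, hgt⟩ | hB0
  · obtain ⟨E, hE, hEc, hEm, hEi, -, hq⟩ := exists_isCompact_setIntegral_eq_zero hBm hAm
      hAB.symm hBfin hAfin hgm hgC (by rwa [add_comm]) hlt hgt hM (by rwa [add_comm])
    exact ⟨E, by rwa [union_comm], hEc, hEm, hEi, hq⟩
  obtain ⟨E, hE, hEc, hEm, hq⟩ :=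
    exists_isCompact_measureReal_eq_and_ratio_rat hAm hBm hAB hAfin hBfin hM hM'
  have hae : ∀ {S : Set ℝ}, MeasurableSet S → volume (S ∩ {x | g x ≠ κ}) = 0 →
      ∫ x in S, g x = volume.real S * κ := by
    intro S hS h0
    have : ∀ᵐ x, x ∈ S → g x = κ := by
      rw [ae_iff]
      convert h0 using 2
      ext x
      simp
    rw [setIntegral_congr_ae hS this, setIntegral_const, smul_eq_mul]
  have hκ : κ = 0 := by
    rw [hae hAm hA0, hae hBm hB0, ← add_mul] at hgmean
    exact (mul_eq_zero.1 hgmean).resolve_left (hM.trans hM').ne'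
  refine ⟨E, hE, hEc, hEm, ?_, hq⟩
  rw [hae hEc.measurableSet, hκ, mul_zero]
  refine measure_mono_null (inter_subset_inter_left _ hE) ?_
  rw [union_inter_distrib_right]
  exact measure_union_null hA0 hB0
end
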